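/- arXiv:1001.2193 — 2 statements merged into one kernel-verified Lean document; each statement's English description precedes it below -/
import Mathlib

section
/- Let Γ be a G-set with at most one valley (that is, Γ has either no y-valley and no z-valley, or exactly one valley in total). Then there exist three vectors u₁, u₂, u₃ ∈ ℤ³ which generate the monoid S(Γ) and which form a ℤ-basis of the lattice M = { u ∈ ℤ³ : wt(u) = 0 }; in particular S(Γ) is a free commutative monoid of rank 3. -/
open scoped BigOperators Classical

namespace GH

/-- Exponent vectors of monomials `x^m y^n z^p`. -/
abbrev N3 : Type := ℕ × ℕ × ℕ

/-- The lattice `ℤ³`. -/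
abbrev Z3 : Type := ℤ × ℤ × ℤ

/-- Inclusion `ℕ³ → ℤ³`. -/
def toZ (v : N3) : Z3 := ((v.1 : ℤ), (v.2.1 : ℤ), (v.2.2 : ℤ))

/-- The weight map `wt(m,n,p) = m + a·n + (r−a)·p (mod r)` on `ℤ³`. -/
def wtZ (r a : ℕ) (v : Z3) : ZMod r :=
  (v.1 : ZMod r) + (a : ZMod r) * (v.2.1 : ZMod r) + ((r - a : ℕ) : ZMod r) * (v.2.2 : ZMod r)

/-- The weight map on `ℕ³`. -/
def wtN (r a : ℕ) (v : N3) : ZMod r := wtZ r a (toZ v)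

/-- A `G`-set: contains the origin, closed under taking summands, and the weight map
restricted to it is a bijection onto `ℤ/rℤ`. -/
structure IsGSet (r a : ℕ) (Γ : Set N3) : Prop where
  zero_mem : (0, 0, 0) ∈ Γ
  dclosed : ∀ u v : N3, u + v ∈ Γ → u ∈ Γ ∧ v ∈ Γ
  bij : Set.BijOn (wtN r a) Γ Set.univ

/-- `wt_Γ(v)`: the (unique, for a `G`-set) element of `Γ` of the same weight as `v`. -/
noncomputable def wtG (r a : ℕ) (Γ : Set N3) (v : N3) : N3 :=
  if h : ∃ w, w ∈ Γ ∧ wtN r a w = wtN r a v then h.choose else (0, 0, 0)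

/-- `(m,n)` is a y-valley of `Γ`. -/
def IsYValley (Γ : Set N3) (m n : ℕ) : Prop :=
  (m, n, 0) ∈ Γ ∧ (m + 1, n, 0) ∈ Γ ∧ (m, n + 1, 0) ∈ Γ ∧ (m + 1, n + 1, 0) ∉ Γ

/-- `(m,n)` is a z-valley of `Γ`. -/
def IsZValley (Γ : Set N3) (m n : ℕ) : Prop :=
  (m, 0, n) ∈ Γ ∧ (m + 1, 0, n) ∈ Γ ∧ (m, 0, n + 1) ∈ Γ ∧ (m + 1, 0, n + 1) ∉ Γ

/-- A primitive `G`-set: it has a y-valley `(i_y, 0)` and a z-valley `(i_z, 0)`. -/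
def IsPrimG (Γ : Set N3) : Prop := (∃ p : ℕ, IsYValley Γ p 0) ∧ (∃ p : ℕ, IsZValley Γ p 0)

/-- `s_Γ(v) = v − wt_Γ(v) ∈ ℤ³`. -/
noncomputable def sG (r a : ℕ) (Γ : Set N3) (v : N3) : Z3 := toZ v - toZ (wtG r a Γ v)

/-- The submonoid `S(Γ)` of `ℤ³` generated by all `s_Γ(v)`. -/
noncomputable def SMon (r a : ℕ) (Γ : Set N3) : AddSubmonoid Z3 :=
  AddSubmonoid.closure (Set.range (sG r a Γ))

/-- The lattice `M = { u ∈ ℤ³ : wt(u) = 0 }` of `G`-invariant monomials. -/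
def latM (r a : ℕ) : Set Z3 := { u | wtZ r a u = 0 }

/-- The standard pairing of `ℝ³` with `ℤ³`. -/
def dotR (α : ℝ × ℝ × ℝ) (u : Z3) : ℝ :=
  α.1 * (u.1 : ℝ) + α.2.1 * (u.2.1 : ℝ) + α.2.2 * (u.2.2 : ℝ)

/-- The cone `σ(Γ) = { α ∈ ℝ³ : ⟨α, s_Γ(v)⟩ ≥ 0 for all v ∈ ℕ³ }`. -/
noncomputable def sigmaCone (r a : ℕ) (Γ : Set N3) : Set (ℝ × ℝ × ℝ) :=
  { α | ∀ v : N3, 0 ≤ dotR α (sG r a Γ v) }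

/-- `span(u₁,…,u_t)`: all `v ∈ ℕ³` dominated componentwise by some `u_s`. -/
def spanSet (s : Set N3) : Set N3 := { v | ∃ u ∈ s, v ≤ u }

/-- `i(Γ)`: the largest `m` with `(m,0,0) ∈ Γ`. -/
noncomputable def iOf (Γ : Set N3) : ℕ := sSup { m : ℕ | (m, 0, 0) ∈ Γ }

/-- `j(Γ)`: the largest `n` with `(0,n,0) ∈ Γ`. -/
noncomputable def jOf (Γ : Set N3) : ℕ := sSup { n : ℕ | (0, n, 0) ∈ Γ }

/-- `k(Γ)`: the largest `p` with `(0,0,p) ∈ Γ`. -/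
noncomputable def kOf (Γ : Set N3) : ℕ := sSup { p : ℕ | (0, 0, p) ∈ Γ }

/-- `c(w) = max { c : w − c·v ∈ ℕ³ }` (componentwise). -/
noncomputable def cmax (v w : N3) : ℕ := sSup { c : ℕ | c • v ≤ w }

/-- The `G`-igsaw transformation of `Γ` in the direction of `u`:
`T_u(Γ) = { w + c(w)·(u − v) : w ∈ Γ }` where `v = wt_Γ(u)`. -/
noncomputable def jig (r a : ℕ) (Γ : Set N3) (u : N3) : Set N3 :=
  { w' | ∃ w ∈ Γ,
      toZ w' = toZ w + (cmax (wtG r a Γ u) w) • (toZ u - toZ (wtG r a Γ u)) }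

/-- The upper transformation `TU(Γ)`. -/
noncomputable def TU (r a : ℕ) (Γ : Set N3) : Set N3 := jig r a Γ (iOf Γ + 1, 0, 0)

/-- The right transformation `TR(Γ)`. -/
noncomputable def TR (r a : ℕ) (Γ : Set N3) : Set N3 := jig r a Γ (0, jOf Γ + 1, 0)

/-- The left transformation `TL(Γ)`. -/
noncomputable def TL (r a : ℕ) (Γ : Set N3) : Set N3 := jig r a Γ (0, 0, kOf Γ + 1)

/-- The y-valley of `Γ` (chosen by choice; unique for a `G`-set having one). -/
noncomputable def yValley (Γ : Set N3) : ℕ × ℕ :=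
  if h : ∃ p : ℕ × ℕ, IsYValley Γ p.1 p.2 then h.choose else (0, 0)

/-- The z-valley of `Γ` (chosen by choice; unique for a `G`-set having one). -/
noncomputable def zValley (Γ : Set N3) : ℕ × ℕ :=
  if h : ∃ p : ℕ × ℕ, IsZValley Γ p.1 p.2 then h.choose else (0, 0)

/-- The upper right transformation `TUR(Γ)`, in the direction `(i_y+1, j_y+1, 0)`. -/
noncomputable def TUR (r a : ℕ) (Γ : Set N3) : Set N3 :=
  jig r a Γ ((yValley Γ).1 + 1, (yValley Γ).2 + 1, 0)

/-- The upper left transformation `TUL(Γ)`, in the direction `(i_z+1, 0, k_z+1)`. -/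
noncomputable def TUL (r a : ℕ) (Γ : Set N3) : Set N3 :=
  jig r a Γ ((zValley Γ).1 + 1, 0, (zValley Γ).2 + 1)

/-- The bound `min{j, k, j − j_y, k − k_z}` for the triangle of transformations. -/
noncomputable def minBound (Γ : Set N3) : ℕ :=
  min (min (jOf Γ) (kOf Γ)) (min (jOf Γ - (yValley Γ).2) (kOf Γ - (zValley Γ).2))

/-- The triangle of transformations `Θ(Γ)`. -/
noncomputable def Theta (r a : ℕ) (Γ : Set N3) : Set (Set N3) :=
  { Γ' | ∃ p q : ℕ, p + q ≤ minBound Γ ∧ Γ' = (TUR r a)^[p] ((TUL r a)^[q] Γ) }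

/-- The recursion step producing `Γ_{n+1}` from `Γ_n`. -/
noncomputable def nextGamma (r a : ℕ) (Γ : Set N3) : Set N3 :=
  if jOf Γ < kOf Γ then TU r a ((TUR r a)^[jOf Γ] Γ)
  else TU r a ((TUL r a)^[kOf Γ] Γ)

/-- The sequence of primitive `G`-sets; `GammaSeq r a b (n-1)` is `Γ_n`,
starting from `Γ₁ = span((1,0,0),(0,b−1,0),(0,0,r−b−1))`. -/
noncomputable def GammaSeq (r a b : ℕ) : ℕ → Set N3
  | 0 => spanSet {(1, 0, 0), (0, b - 1, 0), (0, 0, r - b - 1)}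
  | n + 1 => nextGamma r a (GammaSeq r a b n)


/-- The weight `m + α n - α p` with values in `ℤ/rℤ`, for an arbitrary `α`. -/
def wtα {r : ℕ} (α : ZMod r) (v : N3) : ZMod r :=
  (v.1 : ZMod r) + α * (v.2.1 : ZMod r) - α * (v.2.2 : ZMod r)

/-- A lower set of `ℕ³` which is a set of representatives for the weight `wtα α`. -/
structure IsTransversal {r : ℕ} (α : ZMod r) (Γ : Set N3) : Prop where
  lower : ∀ {u v : N3}, u ≤ v → v ∈ Γ → u ∈ Γ
  inj : ∀ {u v : N3}, u ∈ Γ → v ∈ Γ → wtα α u = wtα α v → u = v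
  surj : ∀ v : N3, ∃ w ∈ Γ, wtα α v = wtα α w

/-- Differences `v - w` with `w ∈ Γ` and `v`, `w` of the same weight. -/
def reductions {r : ℕ} (α : ZMod r) (Γ : Set N3) : Set Z3 :=
  { u | ∃ v : N3, ∃ w ∈ Γ, wtα α v = wtα α w ∧ u = toZ v - toZ w }

/-- The reductions are generated, as a monoid, by three of them. -/
def ThreeGenerated {r : ℕ} (α : ZMod r) (Γ : Set N3) : Prop :=
  ∃ u₁ u₂ u₃ : Z3, u₁ ∈ reductions α Γ ∧ u₂ ∈ reductions α Γ ∧ u₃ ∈ reductions α Γ ∧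
    reductions α Γ ⊆ AddSubmonoid.closure {u₁, u₂, u₃}

/-- Every reduction of `v` lies in `T`. -/
def ReducesIn {r : ℕ} (α : ZMod r) (Γ : Set N3) (T : AddSubmonoid Z3) (v : N3) : Prop :=
  ∀ w ∈ Γ, wtα α v = wtα α w → toZ v - toZ w ∈ T

theorem toZ_add (u v : N3) : toZ (u + v) = toZ u + toZ v := by
  simp [toZ]

theorem wtα_add {r : ℕ} (α : ZMod r) (u v : N3) : wtα α (u + v) = wtα α u + wtα α v := by
  simp [wtα]; ring

namespace IsTransversal

variable {r : ℕ} {α : ZMod r} {Γ : Set N3} {T : AddSubmonoid Z3}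

theorem reducesIn_of (h : IsTransversal α Γ) {v w : N3} (hw : w ∈ Γ) (e : wtα α v = wtα α w)
    (hT : toZ v - toZ w ∈ T) : ReducesIn α Γ T v := by
  intro w' hw' e'
  rwa [h.inj hw' hw (e'.symm.trans e)]

theorem reducesIn_of_mem (h : IsTransversal α Γ) {v : N3} (hv : v ∈ Γ) : ReducesIn α Γ T v :=
  h.reducesIn_of hv rfl (by simp)

theorem reducesIn_add (h : IsTransversal α Γ) {u v : N3} (hu : ReducesIn α Γ T u)
    (hv : ∀ w ∈ Γ, wtα α u = wtα α w → ReducesIn α Γ T (w + v)) : ReducesIn α Γ T (u + v) := by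
  intro z hz e
  obtain ⟨w, hw, ew⟩ := h.surj u
  have h1 := hu w hw ew
  have h2 := hv w hw ew z hz (by rw [← e, wtα_add, wtα_add, ew])
  have := T.add_mem h1 h2
  rw [toZ_add] at this ⊢
  convert this using 1
  abel

/-- Reductions of all monomials lie in `T` once this holds for multiplication of elements of `Γ`
by `y` and by `z`, and for the first power of `x` outside `Γ`, whose representative is
assumed not to involve `x`. -/
theorem reducesIn_all (h : IsTransversal α Γ) {N n₀ p₀ : ℕ} (hN : ∀ m < N, (m, 0, 0) ∈ Γ)
    (hN0 : 0 < N)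
    (hy : ∀ w ∈ Γ, ReducesIn α Γ T (w + (0, 1, 0)))
    (hz : ∀ w ∈ Γ, ReducesIn α Γ T (w + (0, 0, 1)))
    (h₀ : (0, n₀, p₀) ∈ Γ) (e₀ : wtα α (N, 0, 0) = wtα α (0, n₀, p₀))
    (hX : toZ (N, 0, 0) - toZ (0, n₀, p₀) ∈ T) (v : N3) : ReducesIn α Γ T v := by
  have hyn : ∀ n : ℕ, ∀ w, ReducesIn α Γ T w → ReducesIn α Γ T (w + (0, n, 0)) := by
    intro n
    induction n with
    | zero => intro w hw; rwa [show w + (0, 0, 0) = w from add_zero w]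
    | succ n ih =>
      intro w hw
      have := h.reducesIn_add (ih w hw) fun w' hw' _ => hy w' hw'
      simpa [add_assoc] using this
  have hzn : ∀ n : ℕ, ∀ w, ReducesIn α Γ T w → ReducesIn α Γ T (w + (0, 0, n)) := by
    intro n
    induction n with
    | zero => intro w hw; rwa [show w + (0, 0, 0) = w from add_zero w]
    | succ n ih =>
      intro w hw
      have := h.reducesIn_add (ih w hw) fun w' hw' _ => hz w' hw'
      simpa [add_assoc] using this
  have hx : ∀ m : ℕ, ReducesIn α Γ T (m, 0, 0) := by
    intro m
    induction m using Nat.strong_induction_on with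
    | _ m ih =>
      by_cases hm : m < N
      · exact h.reducesIn_of_mem (hN m hm)
      · obtain ⟨k, rfl⟩ := Nat.exists_eq_add_of_le (not_lt.mp hm)
        have : ReducesIn α Γ T ((N, 0, 0) + (k, 0, 0)) := by
          refine h.reducesIn_add (h.reducesIn_of h₀ e₀ hX) fun w hw ew => ?_
          rw [h.inj hw h₀ (ew.symm.trans e₀)]
          simpa using hzn p₀ _ (hyn n₀ _ (ih k (by omega)))
        simpa using this
  obtain ⟨m, n, p⟩ := v
  simpa using hzn p _ (hyn n _ (hx m))

theorem zero_mem (h : IsTransversal α Γ) : (0, 0, 0) ∈ Γ := by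
  obtain ⟨w, hw, -⟩ := h.surj (0, 0, 0)
  exact h.lower (by simp [Prod.le_def]) hw

theorem eq_zero_or (h : IsTransversal α Γ) {m n p : ℕ} (hv : (m, n, p) ∈ Γ) : n = 0 ∨ p = 0 := by
  by_contra! hc
  have h1 : ((0, 1, 1) : N3) ∈ Γ :=
    h.lower (by simp only [Prod.mk_le_mk]; omega) hv
  simpa using h.inj h1 h.zero_mem (by simp [wtα])

theorem reducesIn_cancel_y (h : IsTransversal α Γ) (hT : ((0, 1, 1) : Z3) ∈ T) {m n p : ℕ}
    (hv : (m, n, p) ∈ Γ) (hp : p ≠ 0) : ReducesIn α Γ T ((m, n, p) + (0, 1, 0)) := by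
  obtain ⟨p, rfl⟩ := Nat.exists_eq_succ_of_ne_zero hp
  refine h.reducesIn_of (w := (m, n, p)) (h.lower (by simp) hv) ?_ ?_
  · simp [wtα]; ring
  · simpa [toZ] using hT

theorem reducesIn_cancel_z (h : IsTransversal α Γ) (hT : ((0, 1, 1) : Z3) ∈ T) {m n p : ℕ}
    (hv : (m, n, p) ∈ Γ) (hn : n ≠ 0) : ReducesIn α Γ T ((m, n, p) + (0, 0, 1)) := by
  obtain ⟨n, rfl⟩ := Nat.exists_eq_succ_of_ne_zero hn
  refine h.reducesIn_of (w := (m, n, p)) (h.lower (by simp) hv) ?_ ?_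
  · simp [wtα]; ring
  · simpa [toZ] using hT

theorem threeGenerated_of_staircase (h : IsTransversal α Γ) {p q J J' K : ℕ} (hp : 0 < p)
    (hq : 0 < q) (hJ : J' ≤ J)
    (hy : ∀ m n, (m, n, 0) ∈ Γ ↔ (m < p ∧ n ≤ J) ∨ (p ≤ m ∧ m < p + q ∧ n ≤ J'))
    (hz : ∀ m k, (m, 0, k) ∈ Γ ↔ m < p + q ∧ k ≤ K)
    (hA : wtα α (0, J + 1, 0) = wtα α (q, 0, K))
    (hB : wtα α (p, J' + 1, 0) = wtα α (0, 0, K)) : ThreeGenerated α Γ := by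
  obtain ⟨d, rfl⟩ := Nat.exists_eq_add_of_le hJ
  have eX : wtα α (p + q, 0, 0) = wtα α (0, d, 0) := by
    simp [wtα] at hA hB ⊢
    linear_combination hB - hA
  have mX : ((0, d, 0) : N3) ∈ Γ := by rw [hy]; omega
  have eC : wtα α (0, 0, K + 1) = wtα α (p, J', 0) := by
    simp [wtα] at hA hB ⊢
    linear_combination - hB
  have mC : ((p, J', 0) : N3) ∈ Γ := by rw [hy]; omega
  have mA : ((q, 0, K) : N3) ∈ Γ := by rw [hz]; omega
  set A : Z3 := toZ (0, J' + d + 1, 0) - toZ (q, 0, K)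
  set C : Z3 := toZ (0, 0, K + 1) - toZ (p, J', 0)
  set X : Z3 := toZ (p + q, 0, 0) - toZ (0, d, 0)
  set T := AddSubmonoid.closure ({A, C, X} : Set Z3)
  have tA : A ∈ T := AddSubmonoid.subset_closure (by simp)
  have tC : C ∈ T := AddSubmonoid.subset_closure (by simp)
  have tX : X ∈ T := AddSubmonoid.subset_closure (by simp)
  have tYZ : ((0, 1, 1) : Z3) ∈ T := by
    convert T.add_mem (T.add_mem tA tX) tC using 1
    simp [A, C, X, toZ]
    omega
  refine ⟨A, C, X, ⟨_, _, mA, hA, rfl⟩, ⟨_, _, mC, eC, rfl⟩, ⟨_, _, mX, eX, rfl⟩, ?_⟩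
  rintro _ ⟨v, w, hw, e, rfl⟩
  refine h.reducesIn_all (N := p + q) (fun m hm => ?_) (by omega) ?_ ?_ mX eX tX v w hw e
  · rw [hz]; omega
  · rintro ⟨m, n, k⟩ hw
    by_cases hk : k = 0
    · subst hk
      by_cases hn : ((m, n + 1, 0) : N3) ∈ Γ
      · exact h.reducesIn_of_mem (by simpa using hn)
      · rw [hy] at hw hn
        by_cases hm : m < p
        · obtain rfl : n = J' + d := by omega
          refine h.reducesIn_of (w := (m + q, 0, K)) (by rw [hz]; omega) ?_ ?_
          · simp [wtα] at hA ⊢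
            linear_combination hA
          · convert tA using 1
            simp [A, toZ]
        · obtain rfl : n = J' := by omega
          obtain ⟨k, rfl⟩ := Nat.exists_eq_add_of_le (not_lt.mp hm)
          refine h.reducesIn_of (w := (k, 0, K)) (by rw [hz]; omega) ?_ ?_
          · simp [wtα] at hB ⊢
            linear_combination hB
          · convert T.add_mem tA tX using 1
            simp [A, X, toZ]
            omega
    · exact h.reducesIn_cancel_y tYZ hw hk
  · rintro ⟨m, n, k⟩ hw
    by_cases hn : n = 0
    · subst hn
      by_cases hk : ((m, 0, k + 1) : N3) ∈ Γ
      · exact h.reducesIn_of_mem (by simpa using hk)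
      · rw [hz] at hw hk
        obtain rfl : k = K := by omega
        by_cases hm : m < q
        · refine h.reducesIn_of (w := (m + p, J', 0)) (by rw [hy]; omega) ?_ ?_
          · simp [wtα] at hB ⊢
            linear_combination -hB
          · convert tC using 1
            simp [C, toZ]
        · obtain ⟨l, rfl⟩ := Nat.exists_eq_add_of_le (not_lt.mp hm)
          refine h.reducesIn_of (w := (l, J' + d, 0)) (by rw [hy]; omega) ?_ ?_
          · simp [wtα] at hA ⊢
            linear_combination -hA
          · convert T.add_mem tC tX using 1
            simp [C, X, toZ]
            omega
    · exact h.reducesIn_cancel_z tYZ hw hn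

theorem threeGenerated_of_column (h : IsTransversal α Γ) {J K : ℕ}
    (hx : ∀ m n k, (m, n, k) ∈ Γ → m = 0)
    (hy : ∀ n, (0, n, 0) ∈ Γ ↔ n ≤ J) (hz : ∀ k, (0, 0, k) ∈ Γ ↔ k ≤ K)
    (hA : wtα α (0, J + 1, 0) = wtα α (0, 0, K)) : ThreeGenerated α Γ := by
  obtain ⟨⟨m, n₀, p₀⟩, mX, eX⟩ := h.surj (1, 0, 0)
  obtain rfl := hx _ _ _ mX
  have eC : wtα α (0, 0, K + 1) = wtα α (0, J, 0) := by
    simp [wtα] at hA ⊢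
    linear_combination - hA
  have mC : ((0, J, 0) : N3) ∈ Γ := by rw [hy]
  have mA : ((0, 0, K) : N3) ∈ Γ := by rw [hz]
  set A : Z3 := toZ (0, J + 1, 0) - toZ (0, 0, K)
  set C : Z3 := toZ (0, 0, K + 1) - toZ (0, J, 0)
  set X : Z3 := toZ (1, 0, 0) - toZ (0, n₀, p₀)
  set T := AddSubmonoid.closure ({A, C, X} : Set Z3)
  have tA : A ∈ T := AddSubmonoid.subset_closure (by simp)
  have tC : C ∈ T := AddSubmonoid.subset_closure (by simp)
  have tX : X ∈ T := AddSubmonoid.subset_closure (by simp)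
  have tYZ : ((0, 1, 1) : Z3) ∈ T := by
    convert T.add_mem tA tC using 1
    simp [A, C, toZ]
  refine ⟨A, C, X, ⟨_, _, mA, hA, rfl⟩, ⟨_, _, mC, eC, rfl⟩, ⟨_, _, mX, eX, rfl⟩, ?_⟩
  rintro _ ⟨v, w, hw, e, rfl⟩
  refine h.reducesIn_all (N := 1) (fun m hm => ?_) (by omega) ?_ ?_ mX eX tX v w hw e
  · obtain rfl : m = 0 := by omega
    exact h.zero_mem
  · rintro ⟨m, n, k⟩ hw
    obtain rfl := hx _ _ _ hw
    by_cases hk : k = 0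
    · subst hk
      by_cases hn : ((0, n + 1, 0) : N3) ∈ Γ
      · exact h.reducesIn_of_mem (by simpa using hn)
      · rw [hy] at hw hn
        obtain rfl : n = J := by omega
        exact h.reducesIn_of mA (by simpa using hA) (by simpa using tA)
    · exact h.reducesIn_cancel_y tYZ hw hk
  · rintro ⟨m, n, k⟩ hw
    obtain rfl := hx _ _ _ hw
    by_cases hn : n = 0
    · subst hn
      by_cases hk : ((0, 0, k + 1) : N3) ∈ Γ
      · exact h.reducesIn_of_mem (by simpa using hk)
      · rw [hz] at hw hk
        obtain rfl : k = K := by omega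
        exact h.reducesIn_of mC (by simpa using eC) (by simpa using tC)
    · exact h.reducesIn_cancel_z tYZ hw hn

/-- Let all `z`-columns of `Γ` have height `K`. Multiplying the top of a `y`-column by `y` gives
the weight of the bottom of some `z`-column. -/
theorem exists_next (h : IsTransversal α Γ) {N K : ℕ}
    (hz : ∀ m k, (m, 0, k) ∈ Γ ↔ m < N ∧ k ≤ K) {m n : ℕ} (hmn : (m, n, 0) ∈ Γ)
    (hmn' : (m, n + 1, 0) ∉ Γ) : ∃ m' < N, wtα α (m, n + 1, 0) = wtα α (m', 0, K) := by
  obtain ⟨⟨m', n', k⟩, hw, e⟩ := h.surj (m, n + 1, 0)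
  rcases Nat.eq_zero_or_pos n' with rfl | hn
  · have hk := (hz _ _).1 hw
    rcases hk.2.eq_or_lt with rfl | hlt
    · exact ⟨m', hk.1, e⟩
    · have := h.inj hmn ((hz m' (k + 1)).2 ⟨hk.1, hlt⟩) (by
        simp only [wtα, Nat.cast_add, Nat.cast_one, Nat.cast_zero] at e ⊢
        linear_combination e)
      simp at this
  · obtain ⟨n', rfl⟩ := Nat.exists_eq_succ_of_ne_zero hn.ne'
    have := h.inj hmn (h.lower (u := (m', n', k)) (by simp) hw) (by
      simp only [wtα, Nat.cast_add, Nat.cast_one, Nat.cast_zero, Nat.succ_eq_add_one] at e ⊢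
      linear_combination e)
    simp only [Prod.mk.injEq] at this
    obtain ⟨rfl, rfl, rfl⟩ := this
    exact absurd hw hmn'

/-- Let all `z`-columns of `Γ` have height `K`. Every weight of the bottom of a `z`-column is
obtained by multiplying the top of a `y`-column by `y`. -/
theorem exists_prev (h : IsTransversal α Γ) {N K : ℕ}
    (hz : ∀ m k, (m, 0, k) ∈ Γ ↔ m < N ∧ k ≤ K) {m' : ℕ} (hm' : m' < N) :
    ∃ m n, (m, n, 0) ∈ Γ ∧ (m, n + 1, 0) ∉ Γ ∧ wtα α (m, n + 1, 0) = wtα α (m', 0, K) := by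
  have hK : (m', 0, K) ∈ Γ := (hz _ _).2 ⟨hm', le_rfl⟩
  obtain ⟨⟨m, n, k⟩, hw, e⟩ := h.surj (m', 0, K + 1)
  rcases Nat.eq_zero_or_pos k with rfl | hk
  · have e' : wtα α (m, n + 1, 0) = wtα α (m', 0, K) := by
      simp only [wtα, Nat.cast_add, Nat.cast_one, Nat.cast_zero] at e ⊢
      linear_combination -e
    exact ⟨m, n, hw, fun hc => by simpa using h.inj hc hK e', e'⟩
  · obtain ⟨k, rfl⟩ := Nat.exists_eq_succ_of_ne_zero hk.ne'
    have := h.inj hK (h.lower (u := (m, n, k)) (by simp) hw) (by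
      simp only [wtα, Nat.cast_add, Nat.cast_one, Nat.cast_zero, Nat.succ_eq_add_one] at e ⊢
      linear_combination e)
    simp only [Prod.mk.injEq] at this
    obtain ⟨rfl, rfl, rfl⟩ := this
    have := (hz _ _).1 hw
    omega

theorem not_next_zero [NeZero r] (h : IsTransversal α Γ) (hα : IsUnit α) {J K : ℕ}
    (hx : (1, 0, 0) ∈ Γ) (hJ : (0, J, 0) ∈ Γ) (hK : (0, 0, K) ∈ Γ) :
    wtα α (0, J + 1, 0) ≠ wtα α (0, 0, K) := by
  intro e
  obtain ⟨β, hβ⟩ := hα.exists_right_inv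
  have hL : ((J + 1 + K : ℕ) : ZMod r) = 0 := by
    simp only [wtα, Nat.cast_add, Nat.cast_one, Nat.cast_zero] at e ⊢
    linear_combination β * e - (J + 1 + K : ZMod r) * hβ
  set t := (β + K).val % (J + 1 + K)
  have htL : t < J + 1 + K := Nat.mod_lt _ (by omega)
  have et : (t : ZMod r) = β + K := by
    have := congrArg (Nat.cast : ℕ → ZMod r) (Nat.mod_add_div (β + K).val (J + 1 + K))
    rw [Nat.cast_add, Nat.cast_mul, hL, ZMod.natCast_zmod_val] at this
    simpa using this
  rcases le_total K t with hKt | hKt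
  · obtain ⟨s, hs⟩ := Nat.exists_eq_add_of_le hKt
    have := h.inj hx (h.lower (u := (0, s, 0)) (by simp; omega) hJ) (by
      rw [hs] at et
      simp only [wtα, Nat.cast_add, Nat.cast_one, Nat.cast_zero] at et ⊢
      linear_combination -α * et - hβ)
    simp at this
  · obtain ⟨s, hs⟩ := Nat.exists_eq_add_of_le hKt
    have := h.inj hx (h.lower (u := (0, 0, s)) (by simp; omega) hK) (by
      have hs' := congrArg (Nat.cast : ℕ → ZMod r) hs
      simp only [wtα, Nat.cast_add, Nat.cast_one, Nat.cast_zero] at hs' ⊢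
      linear_combination -α * et - hβ - α * hs')
    simp at this

theorem threeGenerated_of_profile [NeZero r] (h : IsTransversal α Γ) (hα : IsUnit α)
    {N p J J' K : ℕ} (hp : 0 < p) (hpN : p ≤ N) (hJ : J' ≤ J) (hlt : p < N → J' < J)
    (hy : ∀ m n, (m, n, 0) ∈ Γ ↔ (m < p ∧ n ≤ J) ∨ (p ≤ m ∧ m < N ∧ n ≤ J'))
    (hz : ∀ m k, (m, 0, k) ∈ Γ ↔ m < N ∧ k ≤ K) : ThreeGenerated α Γ := by
  have hx : ∀ {m m' : ℕ}, m < N → m' < N → wtα α (m, 0, 0) = wtα α (m', 0, 0) → m = m' := by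
    intro m m' hm hm' e
    simpa using h.inj ((hz m 0).2 ⟨hm, by omega⟩) ((hz m' 0).2 ⟨hm', by omega⟩) e
  rcases Nat.lt_or_ge 1 N with hN | hN
  · have no0 : wtα α (0, J + 1, 0) ≠ wtα α (0, 0, K) :=
      h.not_next_zero hα ((hz 1 0).2 (by omega)) ((hy _ _).2 (by omega)) ((hz _ _).2 (by omega))
    obtain ⟨m, n, h1, h2, e⟩ := h.exists_prev hz (m' := 0) (by omega)
    rw [hy] at h1 h2
    by_cases hN0 : wtα α (N, 0, 0) = wtα α (0, 0, 0)
    · have hpN' : p = N := by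
        by_contra hne
        have hJ' := hlt (by omega)
        set k := (α * (J' + 1)).val
        have hN0' : (N : ZMod r) = 0 := by simpa [wtα] using hN0
        have hk : ((k % N : ℕ) : ZMod r) = α * (J' + 1) := by
          have := congrArg (Nat.cast : ℕ → ZMod r) (Nat.mod_add_div k N)
          rw [Nat.cast_add, Nat.cast_mul, hN0', ZMod.natCast_zmod_val] at this
          simpa using this
        have := h.inj ((hz (k % N) 0).2 ⟨Nat.mod_lt _ (by omega), by omega⟩)
          ((hy 0 (J' + 1)).2 (by omega)) (by simp [wtα, hk])
        simp at this
      subst hpN'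
      obtain rfl : n = J := by omega
      have hm : m ≠ 0 := by rintro rfl; exact no0 e
      obtain ⟨q, rfl⟩ := Nat.exists_eq_add_of_le (show m ≤ p by omega)
      refine h.threeGenerated_of_staircase (p := m) (q := q) (J := n) (J' := n) (by omega)
        (by omega) le_rfl ?_ hz ?_ e
      · intro m' n'
        rw [hy]
        omega
      · simp only [wtα, Nat.cast_add, Nat.cast_one, Nat.cast_zero] at e hN0 ⊢
        linear_combination e - hN0
    · have hm : p < N ∧ m = p ∧ n = J' := by
        rcases Nat.eq_zero_or_pos m with rfl | hm
        · obtain rfl : n = J := by omega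
          exact absurd e no0
        · obtain ⟨m, rfl⟩ := Nat.exists_eq_succ_of_ne_zero hm.ne'
          by_cases hc : ((m, n + 1, 0) : N3) ∈ Γ
          · rw [hy] at hc
            omega
          · exfalso
            obtain ⟨m', hm', e'⟩ := h.exists_next hz (m := m) (n := n) (by rw [hy]; omega) hc
            have e2 : wtα α (m' + 1, 0, 0) = wtα α (0, 0, 0) := by
              simp only [wtα, Nat.cast_add, Nat.cast_one, Nat.cast_zero,
                Nat.succ_eq_add_one] at e e' ⊢
              linear_combination e - e'
            rcases Nat.lt_or_ge (m' + 1) N with hlt' | hge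
            · simpa using hx hlt' (by omega) e2
            · obtain rfl : N = m' + 1 := by omega
              exact hN0 e2
      obtain ⟨hpN', rfl, rfl⟩ := hm
      obtain ⟨q, rfl⟩ := Nat.exists_eq_add_of_le hpN
      refine h.threeGenerated_of_staircase hp (q := q) (by omega) hJ hy hz ?_ e
      obtain ⟨m', n', h1', h2', e'⟩ := h.exists_prev hz (m' := q) (by omega)
      rw [hy] at h1' h2'
      rcases Nat.lt_or_ge m' m with hm' | hm'
      · obtain rfl : n' = J := by omega
        rcases Nat.eq_zero_or_pos m' with rfl | hpos
        · exact e'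
        · exfalso
          obtain ⟨m', rfl⟩ := Nat.exists_eq_succ_of_ne_zero hpos.ne'
          obtain ⟨l, hl, e2⟩ := h.exists_next hz (m := m') (n := n') (by rw [hy]; omega)
            (by rw [hy]; omega)
          have e3 : wtα α (l + 1, 0, 0) = wtα α (q, 0, 0) := by
            simp only [wtα, Nat.cast_add, Nat.cast_one, Nat.cast_zero,
              Nat.succ_eq_add_one] at e' e2 ⊢
            linear_combination e' - e2
          rcases Nat.lt_or_ge (l + 1) (m + q) with hlt' | hge
          · obtain rfl := hx hlt' (by omega) e3
            have := h.inj ((hy m' n').2 (by omega)) ((hy (m + l) n).2 (by omega)) (by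
              simp only [wtα, Nat.cast_add, Nat.cast_one, Nat.cast_zero] at e e2 ⊢
              linear_combination e2 - e)
            simp only [Prod.mk.injEq] at this
            omega
          · have := hx (m := m) (m' := 0) (by omega) (by omega) (by
              have hl' := congrArg (Nat.cast : ℕ → ZMod r) (show l + 1 = m + q by omega)
              simp only [wtα, Nat.cast_add, Nat.cast_one, Nat.cast_zero] at e3 hl' ⊢
              linear_combination e3 - hl')
            omega
      · exfalso
        obtain rfl : n' = n := by omega
        obtain ⟨k, rfl⟩ := Nat.exists_eq_add_of_le hm'
        have := hx (m := k) (m' := q) (by omega) (by omega) (by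
          simp only [wtα, Nat.cast_add, Nat.cast_one, Nat.cast_zero] at e e' ⊢
          linear_combination e' - e)
        omega
  · obtain rfl : N = 1 := by omega
    obtain rfl : p = 1 := by omega
    obtain ⟨m', hm', e⟩ := h.exists_next hz (m := 0) (n := J) (by rw [hy]; omega)
      (by rw [hy]; omega)
    obtain rfl : m' = 0 := by omega
    refine h.threeGenerated_of_column (J := J) (K := K) (fun m n k hw => ?_) (fun n => ?_)
      (fun k => ?_) e
    · have := (hz m 0).1 (h.lower (by simp) hw)
      omega
    · rw [hy]; omega
    · rw [hz]; omega

theorem exists_height {P : ℕ → Prop} (hP : ∀ m n, m ≤ n → P n → P m) (hne : ∃ n, ¬ P n) :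
    ∃ k, ∀ n, P n ↔ n < k := by
  refine ⟨Nat.find hne, fun n => ⟨fun hn => ?_, fun hn => not_not.1 (Nat.find_min hne hn)⟩⟩
  by_contra hc
  exact Nat.find_spec hne (hP _ _ (not_lt.1 hc) hn)

theorem eq_of_forall_succ_eq {F : ℕ → ℕ} {a b : ℕ}
    (hF : ∀ m, a ≤ m → m + 1 < b → F (m + 1) = F m) {m : ℕ} (hm : a ≤ m) (hmb : m < b) :
    F m = F a := by
  induction m, hm using Nat.le_induction with
  | base => rfl
  | succ m hm ih => rw [hF m hm hmb, ih (by omega)]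

theorem threeGenerated_of_yValleys [NeZero r] (h : IsTransversal α Γ) (hα : IsUnit α)
    (hzv : ∀ m n, ¬ IsZValley Γ m n)
    (hyv : ∀ m n m' n', IsYValley Γ m n → IsYValley Γ m' n' → m = m') : ThreeGenerated α Γ := by
  have hr : r ≠ 0 := NeZero.ne r
  have hFex : ∀ m, ∃ k, ∀ n, (m, n, 0) ∈ Γ ↔ n < k := fun m =>
    exists_height (fun n n' hn hn' => h.lower (by simpa using hn) hn') ⟨r, fun hc => by
      have := h.inj (h.lower (u := (0, r, 0)) (by simp) hc) h.zero_mem (by simp [wtα])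
      simp_all⟩
  have hGex : ∀ m, ∃ k, ∀ n, (m, 0, n) ∈ Γ ↔ n < k := fun m =>
    exists_height (fun n n' hn hn' => h.lower (by simpa using hn) hn') ⟨r, fun hc => by
      have := h.inj (h.lower (u := (0, 0, r)) (by simp) hc) h.zero_mem (by simp [wtα])
      simp_all⟩
  obtain ⟨N, hN⟩ := exists_height (P := fun m => (m, 0, 0) ∈ Γ)
    (fun n n' hn hn' => h.lower (by simpa using hn) hn') ⟨r, fun hc => by
      have := h.inj hc h.zero_mem (by simp [wtα])
      simp_all⟩
  choose F hF using hFex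
  choose G hG using hGex
  have hN0 : 0 < N := (hN 0).1 h.zero_mem
  have hFN : ∀ m, 0 < F m ↔ m < N := fun m => by rw [← hF, ← hN]
  have hGN : ∀ m, 0 < G m ↔ m < N := fun m => by rw [← hG, ← hN]
  have hFa : ∀ m, F (m + 1) ≤ F m := fun m => by
    by_contra! hc
    rw [← hF] at hc
    exact lt_irrefl _ ((hF _ _).1 (h.lower (u := (m, F m, 0)) (by simp) hc))
  have hGa : ∀ m, G (m + 1) ≤ G m := fun m => by
    by_contra! hc
    rw [← hG] at hc
    exact lt_irrefl _ ((hG _ _).1 (h.lower (u := (m, 0, G m)) (by simp) hc))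
  have hFv : ∀ m, m + 1 < N → F (m + 1) ≠ F m → IsYValley Γ m (F (m + 1) - 1) := by
    intro m hm hne
    have h1 := hFa m
    have h2 := (hFN (m + 1)).2 hm
    simp only [IsYValley, hF]
    omega
  have hGc : ∀ m, m + 1 < N → G (m + 1) = G m := by
    intro m hm
    by_contra hne
    have h1 := hGa m
    have h2 := (hGN (m + 1)).2 hm
    refine hzv m (G (m + 1) - 1) ?_
    simp only [IsZValley, hG]
    omega
  have hF0 := (hFN 0).2 hN0
  have hG0 := (hGN 0).2 hN0
  have hz : ∀ m k, (m, 0, k) ∈ Γ ↔ m < N ∧ k ≤ G 0 - 1 := by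
    intro m k
    rw [hG]
    have h1 := hGN m
    have h2 := fun hm => eq_of_forall_succ_eq (F := G) (a := 0) (b := N) (m := m)
      (fun m _ => hGc m) (by omega) hm
    omega
  by_cases hd : ∃ m, m + 1 < N ∧ F (m + 1) ≠ F m
  · obtain ⟨p, hp, hne⟩ := hd
    have hc : ∀ m, m + 1 < N → m ≠ p → F (m + 1) = F m := by
      intro m hm hmp
      by_contra hc
      exact hmp (hyv _ _ _ _ (hFv m hm hc) (hFv p hp hne))
    have c1 : ∀ m, m < p + 1 → F m = F 0 := fun m hm =>
      eq_of_forall_succ_eq (b := p + 1) (fun m _ hm => hc m (by omega) (by omega)) (by omega) hm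
    have c2 : ∀ m, p + 1 ≤ m → m < N → F m = F (p + 1) := fun m hm hm' =>
      eq_of_forall_succ_eq (b := N) (fun m _ hm => hc m (by omega) (by omega)) hm hm'
    have h1 := hFa p
    have h2 := c1 p (by omega)
    have h3 := (hFN (p + 1)).2 hp
    refine h.threeGenerated_of_profile hα (N := N) (p := p + 1) (J := F 0 - 1)
      (J' := F (p + 1) - 1) (by omega) (by omega) (by omega) (by omega) (fun m n => ?_) hz
    rw [hF]
    have := c1 m
    have := c2 m
    have := hFN m
    omega
  · have hc : ∀ m, m + 1 < N → F (m + 1) = F m := by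
      intro m hm
      by_contra hc
      exact hd ⟨m, hm, hc⟩
    refine h.threeGenerated_of_profile hα (N := N) (p := N) (J := F 0 - 1)
      (J' := F 0 - 1) (by omega) (by omega) (by omega) (by omega) (fun m n => ?_) hz
    rw [hF]
    have h1 := hFN m
    have h2 := fun hm => eq_of_forall_succ_eq (F := F) (a := 0) (b := N) (m := m)
      (fun m _ => hc m) (by omega) hm
    omega

end IsTransversal

/-- Exchange of `y` and `z`. -/
def swapYZ (v : N3) : N3 := (v.1, v.2.2, v.2.1)

theorem wtα_swapYZ {r : ℕ} (α : ZMod r) (v : N3) : wtα α (swapYZ v) = wtα (-α) v := by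
  simp [wtα, swapYZ]; ring

theorem swapYZ_swapYZ (v : N3) : swapYZ (swapYZ v) = v := rfl

theorem IsTransversal.swap {r : ℕ} {α : ZMod r} {Γ : Set N3} (h : IsTransversal α Γ) :
    IsTransversal (-α) (swapYZ ⁻¹' Γ) where
  lower {u v} huv hv := h.lower (u := swapYZ u) (by
    simp only [Prod.le_def, swapYZ] at huv ⊢
    tauto) hv
  inj {u v} hu hv e := by
    have := h.inj hu hv (by rw [wtα_swapYZ, wtα_swapYZ, e])
    rw [← swapYZ_swapYZ u, this, swapYZ_swapYZ]
  surj v := by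
    obtain ⟨w, hw, e⟩ := h.surj (swapYZ v)
    refine ⟨swapYZ w, hw, ?_⟩
    rw [← wtα_swapYZ, ← wtα_swapYZ, e, swapYZ_swapYZ]

/-- Exchange of the last two coordinates. -/
def swapHom : Z3 →+ Z3 where
  toFun v := (v.1, v.2.2, v.2.1)
  map_zero' := rfl
  map_add' _ _ := rfl

theorem swapHom_mem_reductions {r : ℕ} {α : ZMod r} {Γ : Set N3} {u : Z3} :
    swapHom u ∈ reductions α Γ ↔ u ∈ reductions (-α) (swapYZ ⁻¹' Γ) := by
  constructor
  · rintro ⟨v, w, hw, e, hu⟩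
    refine ⟨swapYZ v, swapYZ w, hw, by rw [← wtα_swapYZ, ← wtα_swapYZ]; exact e, ?_⟩
    exact congrArg swapHom hu
  · rintro ⟨v, w, hw, e, rfl⟩
    exact ⟨swapYZ v, swapYZ w, hw, by rw [wtα_swapYZ, wtα_swapYZ, e], rfl⟩

theorem ThreeGenerated.of_swap {r : ℕ} {α : ZMod r} {Γ : Set N3}
    (h : ThreeGenerated (-α) (swapYZ ⁻¹' Γ)) : ThreeGenerated α Γ := by
  obtain ⟨u₁, u₂, u₃, h₁, h₂, h₃, hsub⟩ := h
  refine ⟨swapHom u₁, swapHom u₂, swapHom u₃, swapHom_mem_reductions.2 h₁,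
    swapHom_mem_reductions.2 h₂, swapHom_mem_reductions.2 h₃, fun u hu => ?_⟩
  have hmem := hsub ((swapHom_mem_reductions (u := swapHom u)).1 hu)
  have := AddSubmonoid.mem_map_of_mem swapHom hmem
  rw [AddMonoidHom.map_mclosure, Set.image_insert_eq, Set.image_pair] at this
  exact this

theorem wtN_eq_wtα {r a : ℕ} (har : a ≤ r) (v : N3) : wtN r a v = wtα (a : ZMod r) v := by
  simp [wtN, wtZ, wtα, toZ, Nat.cast_sub har]
  ring

theorem IsGSet.isTransversal {r a : ℕ} (har : a ≤ r) {Γ : Set N3} (hΓ : IsGSet r a Γ) :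
    IsTransversal (a : ZMod r) Γ where
  lower {u v} huv hv := by
    obtain ⟨w, rfl⟩ := exists_add_of_le huv
    exact (hΓ.dclosed u w hv).1
  inj {u v} hu hv e := hΓ.bij.injOn hu hv (by rw [wtN_eq_wtα har, wtN_eq_wtα har, e])
  surj v := by
    obtain ⟨w, hw, e⟩ := hΓ.bij.surjOn (Set.mem_univ (wtN r a v))
    exact ⟨w, hw, by rw [← wtN_eq_wtα har, ← wtN_eq_wtα har, e]⟩

theorem IsGSet.range_sG {r a : ℕ} (har : a ≤ r) {Γ : Set N3} (hΓ : IsGSet r a Γ) :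
    Set.range (sG r a Γ) = reductions (a : ZMod r) Γ := by
  have hw : ∀ v, wtG r a Γ v ∈ Γ ∧ wtN r a (wtG r a Γ v) = wtN r a v := by
    intro v
    have hex : ∃ w, w ∈ Γ ∧ wtN r a w = wtN r a v := hΓ.bij.surjOn (Set.mem_univ (wtN r a v))
    rw [wtG, dif_pos hex]
    exact hex.choose_spec
  ext u
  constructor
  · rintro ⟨v, rfl⟩
    exact ⟨v, wtG r a Γ v, (hw v).1, by rw [← wtN_eq_wtα har, ← wtN_eq_wtα har, (hw v).2], rfl⟩
  · rintro ⟨v, w, hwΓ, e, rfl⟩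
    refine ⟨v, ?_⟩
    rw [sG, (hΓ.isTransversal har).inj hwΓ (hw v).1
      (by rw [← e, ← wtN_eq_wtα har, ← wtN_eq_wtα har, (hw v).2])]

theorem wtZ_sub (r a : ℕ) (u v : Z3) : wtZ r a (u - v) = wtZ r a u - wtZ r a v := by
  simp [wtZ]; ring

theorem reductions_subset_latM {r a : ℕ} (har : a ≤ r) {Γ : Set N3} :
    reductions (a : ZMod r) Γ ⊆ latM r a := by
  rintro _ ⟨v, w, -, e, rfl⟩
  rw [← wtN_eq_wtα har, ← wtN_eq_wtα har] at e
  simp only [latM, Set.mem_ofPred_eq, wtZ_sub]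
  exact sub_eq_zero.2 e

theorem exists_sub_of_mem_latM {r a : ℕ} (har : a ≤ r) {Γ : Set N3}
    (h : IsTransversal (a : ZMod r) Γ) {u : Z3} (hu : u ∈ latM r a) :
    ∃ s ∈ reductions (a : ZMod r) Γ, ∃ t ∈ reductions (a : ZMod r) Γ, u = s - t := by
  set v₁ : N3 := (u.1.toNat, u.2.1.toNat, u.2.2.toNat)
  set v₂ : N3 := ((-u.1).toNat, (-u.2.1).toNat, (-u.2.2).toNat)
  have hu' : u = toZ v₁ - toZ v₂ := by
    ext <;> simp only [toZ, v₁, v₂, Prod.fst_sub, Prod.snd_sub] <;> omega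
  have e : wtα (a : ZMod r) v₁ = wtα (a : ZMod r) v₂ := by
    rw [← wtN_eq_wtα har, ← wtN_eq_wtα har]
    rw [hu'] at hu
    simp only [latM, Set.mem_ofPred_eq, wtZ_sub] at hu
    exact sub_eq_zero.1 hu
  obtain ⟨w, hw, ew⟩ := h.surj v₁
  exact ⟨_, ⟨v₁, w, hw, ew, rfl⟩, _, ⟨v₂, w, hw, e.symm.trans ew, rfl⟩, by rw [hu']; abel⟩

theorem exists_int_combination {u₁ u₂ u₃ u : Z3}
    (hu : u ∈ AddSubmonoid.closure ({u₁, u₂, u₃} : Set Z3)) :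
    ∃ c : ℤ × ℤ × ℤ, u = c.1 • u₁ + c.2.1 • u₂ + c.2.2 • u₃ := by
  induction hu using AddSubmonoid.closure_induction with
  | mem x hx =>
    rcases hx with rfl | rfl | rfl
    · exact ⟨(1, 0, 0), by simp⟩
    · exact ⟨(0, 1, 0), by simp⟩
    · exact ⟨(0, 0, 1), by simp⟩
  | zero => exact ⟨0, by simp⟩
  | add x y _ _ hx hy =>
    obtain ⟨c, rfl⟩ := hx
    obtain ⟨d, rfl⟩ := hy
    exact ⟨c + d, by simp only [Prod.fst_add, Prod.snd_add, add_smul]; abel⟩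

/-- Three vectors of `ℤ³` whose integral combinations include a nonzero multiple of each unit
vector are linearly independent. -/
theorem combination_injective {u₁ u₂ u₃ : Z3} {k : ℤ} (hk : k ≠ 0)
    (h₁ : ∃ c : ℤ × ℤ × ℤ, (k, 0, 0) = c.1 • u₁ + c.2.1 • u₂ + c.2.2 • u₃)
    (h₂ : ∃ c : ℤ × ℤ × ℤ, (0, k, 0) = c.1 • u₁ + c.2.1 • u₂ + c.2.2 • u₃)
    (h₃ : ∃ c : ℤ × ℤ × ℤ, (0, 0, k) = c.1 • u₁ + c.2.1 • u₂ + c.2.2 • u₃) :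
    Function.Injective fun c : ℤ × ℤ × ℤ => c.1 • u₁ + c.2.1 • u₂ + c.2.2 • u₃ := by
  obtain ⟨⟨a₁, a₂, a₃⟩, ha⟩ := h₁
  obtain ⟨⟨b₁, b₂, b₃⟩, hb⟩ := h₂
  obtain ⟨⟨c₁, c₂, c₃⟩, hc⟩ := h₃
  obtain ⟨x₁, y₁, z₁⟩ := u₁
  obtain ⟨x₂, y₂, z₂⟩ := u₂
  obtain ⟨x₃, y₃, z₃⟩ := u₃
  simp only [Prod.smul_mk, smul_eq_mul, Prod.mk_add_mk, Prod.mk.injEq] at ha hb hc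
  set U : Matrix (Fin 3) (Fin 3) ℤ := !![x₁, y₁, z₁; x₂, y₂, z₂; x₃, y₃, z₃]
  have hdet : U.det ≠ 0 := by
    have hmul : !![a₁, a₂, a₃; b₁, b₂, b₃; c₁, c₂, c₃] * U = Matrix.diagonal fun _ => k := by
      ext i j
      fin_cases i <;> fin_cases j <;>
        simp [U, Matrix.mul_apply, Fin.sum_univ_three, Matrix.diagonal] <;> omega
    have := congrArg Matrix.det hmul
    rw [Matrix.det_mul, Matrix.det_diagonal] at this
    refine right_ne_zero_of_mul (this.trans_ne ?_)
    simpa using hk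
  rintro ⟨s₁, s₂, s₃⟩ ⟨t₁, t₂, t₃⟩ e
  simp only [Prod.smul_mk, smul_eq_mul, Prod.mk_add_mk, Prod.mk.injEq] at e
  have := Matrix.eq_zero_of_vecMul_eq_zero hdet (v := ![s₁ - t₁, s₂ - t₂, s₃ - t₃]) (by
    ext j
    fin_cases j <;> simp [U, Matrix.vecMul, dotProduct, Fin.sum_univ_three] <;> linarith)
  have e1 := congrFun this 0
  have e2 := congrFun this 1
  have e3 := congrFun this 2
  simp at e1 e2 e3
  simp only [Prod.mk.injEq]
  omega

/-- For a `G`-set with at most one valley, `S(Γ)` is generated by three vectors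
forming a `ℤ`-basis of the lattice `M`; in particular `S(Γ)` is free of rank 3. -/
theorem stmt8 (r a : ℕ) (hra : Nat.Coprime r a) (ha2 : 2 ≤ a) (halt : a < r - a) (Γ : Set N3) (hΓ : IsGSet r a Γ)
    (hval : { q : ℕ × ℕ × Bool |
        (q.2.2 = true ∧ IsYValley Γ q.1 q.2.1) ∨
        (q.2.2 = false ∧ IsZValley Γ q.1 q.2.1) }.Subsingleton) :
    ∃ u₁ u₂ u₃ : Z3,
      SMon r a Γ = AddSubmonoid.closure {u₁, u₂, u₃} ∧
      u₁ ∈ latM r a ∧ u₂ ∈ latM r a ∧ u₃ ∈ latM r a ∧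
      ∀ u ∈ latM r a, ∃! c : ℤ × ℤ × ℤ, u = c.1 • u₁ + c.2.1 • u₂ + c.2.2 • u₃ := by
  have har : a ≤ r := by omega
  have : NeZero r := ⟨by omega⟩
  have h := hΓ.isTransversal har
  have hα : IsUnit (a : ZMod r) := (ZMod.isUnit_iff_coprime a r).2 hra.symm
  have key : ThreeGenerated (a : ZMod r) Γ := by
    by_cases hzv : ∃ m n, IsZValley Γ m n
    · obtain ⟨m, n, hmn⟩ := hzv
      refine ThreeGenerated.of_swap (h.swap.threeGenerated_of_yValleys hα.neg ?_ ?_)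
      · intro m' n' h'
        have := hval (show (m, n, false) ∈ _ from Or.inr ⟨rfl, hmn⟩)
          (show (m', n', true) ∈ _ from Or.inl ⟨rfl, h'⟩)
        simp at this
      · intro m₁ n₁ m₂ n₂ h₁ h₂
        have := hval (show (m₁, n₁, false) ∈ _ from Or.inr ⟨rfl, h₁⟩)
          (show (m₂, n₂, false) ∈ _ from Or.inr ⟨rfl, h₂⟩)
        simp only [Prod.mk.injEq] at this
        exact this.1
    · push Not at hzv
      refine h.threeGenerated_of_yValleys hα hzv fun m₁ n₁ m₂ n₂ h₁ h₂ => ?_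
      have := hval (show (m₁, n₁, true) ∈ _ from Or.inl ⟨rfl, h₁⟩)
        (show (m₂, n₂, true) ∈ _ from Or.inl ⟨rfl, h₂⟩)
      simp only [Prod.mk.injEq] at this
      exact this.1
  obtain ⟨u₁, u₂, u₃, h₁, h₂, h₃, hsub⟩ := key
  have hlat := reductions_subset_latM (Γ := Γ) har
  have hcomb : ∀ u ∈ latM r a, ∃ c : ℤ × ℤ × ℤ, u = c.1 • u₁ + c.2.1 • u₂ + c.2.2 • u₃ := by
    intro u hu
    obtain ⟨s, hs, t, ht, rfl⟩ := exists_sub_of_mem_latM har h hu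
    obtain ⟨c, hc⟩ := exists_int_combination (hsub hs)
    obtain ⟨d, hd⟩ := exists_int_combination (hsub ht)
    refine ⟨c - d, ?_⟩
    rw [hc, hd]
    simp only [Prod.fst_sub, Prod.snd_sub, sub_smul]
    abel
  refine ⟨u₁, u₂, u₃, ?_, hlat h₁, hlat h₂, hlat h₃, fun u hu => ?_⟩
  · rw [SMon, hΓ.range_sG har]
    refine le_antisymm (AddSubmonoid.closure_le.2 hsub) (AddSubmonoid.closure_mono ?_)
    rintro _ (rfl | rfl | rfl) <;> assumption
  · obtain ⟨c, hc⟩ := hcomb u hu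
    have hr : (r : ℤ) ≠ 0 := by exact_mod_cast NeZero.ne r
    exact ⟨c, hc, fun d hd => combination_injective hr (hcomb _ (by simp [latM, wtZ]))
      (hcomb _ (by simp [latM, wtZ])) (hcomb _ (by simp [latM, wtZ])) (hd.symm.trans hc)⟩

end GH
end

section
/- Let Γ = span((i_y,j,0),(i,0,k)) be a G-set with i_y < i whose only valley is the y-valley (i_y,0), where i = i(Γ), j = j(Γ), k = k(Γ). Then TU(Γ) = span((i+i_y+1,0,0),(i_y,j−1,0),(i,0,k)). Moreover: if j = 1 and k = 0 then TU(Γ) = {(m,0,0) : 0 ≤ m ≤ r−1}; if j = 1 and k > 0 then TU(Γ) has exactly one valley, namely the z-valley (i,0); and if j ≥ 2 and k > 0 then TU(Γ) has exactly two valleys, the y-valley (i_y,0) and the z-valley (i,0). Symmetrically, if Γ = span((i,j,0),(i_z,0,k)) is a G-set with i_z < i whose only valley is the z-valley (i_z,0), then TU(Γ) = span((i+i_z+1,0,0),(i,j,0),(i_z,0,k−1)). -/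
open scoped BigOperators Classical

namespace GH

theorem mem_spanSet_pair {u v w : N3} : w ∈ spanSet {u, v} ↔ w ≤ u ∨ w ≤ v := by
  simp [spanSet]

theorem mem_spanSet_triple {t u v w : N3} :
    w ∈ spanSet {t, u, v} ↔ w ≤ t ∨ w ≤ u ∨ w ≤ v := by
  simp [spanSet]

theorem wtN_mk {r a : ℕ} (h : a ≤ r) (m n p : ℕ) :
    wtN r a (m, n, p) = (m : ZMod r) + (a : ZMod r) * n - (a : ZMod r) * p := by
  simp [wtN, wtZ, toZ, Nat.cast_sub h]
  ring

theorem IsGSet.wtG_eq {r a : ℕ} {Γ : Set N3} (hΓ : IsGSet r a Γ) {u w : N3} (hw : w ∈ Γ)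
    (h : wtN r a w = wtN r a u) : wtG r a Γ u = w := by
  have hex : ∃ w, w ∈ Γ ∧ wtN r a w = wtN r a u := ⟨w, hw, h⟩
  rw [wtG, dif_pos hex]
  exact hΓ.bij.injOn hex.choose_spec.1 hw (hex.choose_spec.2.trans h.symm)

/-- The weight relation `x^(i+1) ~ y^j` for an L-shaped set of exponents
`span((i', j, 0), (i, 0, k))` on which the weight `m + A n - A p` is bijective. -/
theorem weight_succ_eq_of_bijective {r : ℕ} (A : ZMod r) (P : ℕ → ℕ → ℕ → Prop) {i i' j k : ℕ}
    (hi : i' < i) (hj : 1 ≤ j)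
    (hP : ∀ m n p, P m n p ↔ (m ≤ i' ∧ n ≤ j ∧ p = 0) ∨ (m ≤ i ∧ n = 0 ∧ p ≤ k))
    (hinj : ∀ m n p m' n' p', P m n p → P m' n' p' →
      (m : ZMod r) + A * n - A * p = m' + A * n' - A * p' → m = m' ∧ n = n' ∧ p = p')
    (hsurj : ∀ x : ZMod r, ∃ m n p, P m n p ∧ (m : ZMod r) + A * n - A * p = x) :
    (i : ZMod r) + 1 = A * j := by
  have hvalley : (i' : ZMod r) + 1 = -A * (k + 1) := by
    obtain ⟨m, n, p, hmem, h⟩ := hsurj (i' + 1 + A)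
    rw [hP] at hmem
    obtain rfl : m = 0 := by
      by_contra hm
      obtain ⟨m, rfl⟩ := Nat.exists_eq_succ_of_ne_zero hm
      have := hinj m n p i' 1 0 ((hP _ _ _).2 (by omega)) ((hP _ _ _).2 (by omega))
        (by push_cast at h ⊢; linear_combination h)
      omega
    obtain rfl : n = 0 := by
      by_contra hn
      obtain ⟨n, rfl⟩ := Nat.exists_eq_succ_of_ne_zero hn
      have := hinj 0 n p (i' + 1) 0 0 ((hP _ _ _).2 (by omega)) ((hP _ _ _).2 (by omega))
        (by push_cast at h ⊢; linear_combination h)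
      omega
    obtain rfl : p = k := by
      by_contra hp
      have := hinj 0 0 (p + 1) (i' + 1) 0 0 ((hP _ _ _).2 (by omega)) ((hP _ _ _).2 (by omega))
        (by push_cast at h ⊢; linear_combination h)
      omega
    push_cast at h
    linear_combination -h
  obtain ⟨d, rfl⟩ := Nat.exists_eq_add_of_lt hi
  obtain ⟨m, n, p, hmem, h⟩ := hsurj ((i' + d + 1 : ℕ) + 1)
  rw [hP] at hmem
  obtain rfl : m = 0 := by
    by_contra hm
    obtain ⟨m, rfl⟩ := Nat.exists_eq_succ_of_ne_zero hm
    have := hinj m n p (i' + d + 1) 0 0 ((hP _ _ _).2 (by omega)) ((hP _ _ _).2 (by omega))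
      (by push_cast at h ⊢; linear_combination h)
    omega
  rcases Nat.eq_zero_or_pos n with rfl | hn
  · exfalso
    rcases Nat.eq_zero_or_pos p with rfl | hp
    · have := hinj (d + 1) 0 k 0 1 0 ((hP _ _ _).2 (by omega)) ((hP _ _ _).2 (by omega))
        (by push_cast at h ⊢; linear_combination -h - hvalley)
      omega
    · obtain ⟨e, rfl⟩ := Nat.exists_eq_add_of_le (show p ≤ k by omega)
      have := hinj (d + 1) 0 (e + 1) 0 0 0 ((hP _ _ _).2 (by omega)) ((hP _ _ _).2 (by omega))
        (by push_cast at h hvalley ⊢; linear_combination -h - hvalley)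
      omega
  · obtain rfl : p = 0 := by omega
    obtain ⟨e, rfl⟩ := Nat.exists_eq_add_of_le (show n ≤ j by omega)
    rcases Nat.eq_zero_or_pos e with rfl | he
    · push_cast at h ⊢
      linear_combination -h
    exfalso
    obtain ⟨m, n', p, hmem', h'⟩ := hsurj (A * (n + e + 1))
    rw [hP] at hmem'
    obtain rfl : n' = 0 := by
      by_contra hn'
      obtain ⟨n', rfl⟩ := Nat.exists_eq_succ_of_ne_zero hn'
      have := hinj m n' p 0 (n + e) 0 ((hP _ _ _).2 (by omega)) ((hP _ _ _).2 (by omega))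
        (by push_cast at h' ⊢; linear_combination h')
      omega
    obtain rfl : p = k := by
      by_contra hp
      have := hinj m 0 (p + 1) 0 (n + e) 0 ((hP _ _ _).2 (by omega)) ((hP _ _ _).2 (by omega))
        (by push_cast at h' ⊢; linear_combination h')
      omega
    rcases Nat.lt_or_ge m (d + 1) with hm | hm
    · have := hinj (m + i' + 1) 0 0 0 (n + e) 0 ((hP _ _ _).2 (by omega))
        ((hP _ _ _).2 (by omega)) (by push_cast at h' ⊢; linear_combination h' + hvalley)
      omega
    · obtain ⟨t, rfl⟩ := Nat.exists_eq_add_of_le hm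
      have := hinj t 0 0 0 e 0 ((hP _ _ _).2 (by omega)) ((hP _ _ _).2 (by omega))
        (by push_cast at h h' ⊢; linear_combination h' + hvalley + h)
      omega

theorem iOf_eq {Γ : Set N3} {i : ℕ} (hΓ : ∀ m, (m, 0, 0) ∈ Γ ↔ m ≤ i) : iOf Γ = i := by
  have h : {m : ℕ | (m, 0, 0) ∈ Γ} = Set.Iic i := Set.ext hΓ
  rw [iOf, h, csSup_Iic]

theorem cmax_y {j : ℕ} (hj : 1 ≤ j) (m n p : ℕ) : cmax (0, j, 0) (m, n, p) = n / j := by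
  have h : {c : ℕ | c • ((0, j, 0) : N3) ≤ (m, n, p)} = Set.Iic (n / j) := by
    ext c
    simp [Prod.le_def, Nat.le_div_iff_mul_le hj]
  rw [cmax, h, csSup_Iic]

theorem cmax_z {k : ℕ} (hk : 1 ≤ k) (m n p : ℕ) : cmax (0, 0, k) (m, n, p) = p / k := by
  have h : {c : ℕ | c • ((0, 0, k) : N3) ≤ (m, n, p)} = Set.Iic (p / k) := by
    ext c
    simp [Prod.le_def, Nat.le_div_iff_mul_le hk]
  rw [cmax, h, csSup_Iic]

theorem div_eq_ite_of_le {n j : ℕ} (hj : 1 ≤ j) (hn : n ≤ j) :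
    n / j = if n = j then 1 else 0 := by
  split_ifs with h
  · rw [h, Nat.div_self hj]
  · exact Nat.div_eq_of_lt (by omega)

theorem TU_span_y {r a : ℕ} (har : a ≤ r) {i i' j k : ℕ} (hi : i' < i) (hj : 1 ≤ j)
    (hΓ : IsGSet r a (spanSet {(i', j, 0), (i, 0, k)})) :
    TU r a (spanSet {(i', j, 0), (i, 0, k)}) =
      spanSet {(i + i' + 1, 0, 0), (i', j - 1, 0), (i, 0, k)} := by
  have hwt : (i : ZMod r) + 1 = (a : ZMod r) * j := by
    refine weight_succ_eq_of_bijective (a : ZMod r)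
      (fun m n p => (m, n, p) ∈ spanSet {(i', j, 0), (i, 0, k)}) (k := k) hi hj
      (fun m n p => by simp [mem_spanSet_pair]) ?_ ?_
    · intro m n p m' n' p' h h' he
      have := hΓ.bij.injOn h h' (by rw [wtN_mk har, wtN_mk har, he])
      simpa using this
    · intro x
      obtain ⟨⟨m, n, p⟩, hmem, h⟩ := hΓ.bij.surjOn (Set.mem_univ x)
      exact ⟨m, n, p, hmem, by rw [← h, wtN_mk har]⟩
  have hv : wtG r a (spanSet {(i', j, 0), (i, 0, k)}) (i + 1, 0, 0) = (0, j, 0) :=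
    hΓ.wtG_eq (by simp [mem_spanSet_pair]) (by
      rw [wtN_mk har, wtN_mk har]; push_cast; linear_combination -hwt)
  have hiOf : iOf (spanSet {(i', j, 0), (i, 0, k)}) = i :=
    iOf_eq fun m => by simp [mem_spanSet_pair]; omega
  ext ⟨m, n, p⟩
  rw [TU, hiOf, jig, hv, mem_spanSet_triple]
  simp only [Set.mem_ofPred_eq, Prod.exists, mem_spanSet_pair, cmax_y hj, toZ, Prod.mk_le_mk,
    Prod.mk_sub_mk, Prod.smul_mk, Prod.mk_add_mk, Prod.mk.injEq]
  constructor
  · rintro ⟨m', n', p', hmem, h1, h2, h3⟩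
    rw [div_eq_ite_of_le hj (by omega)] at h1 h2 h3
    split_ifs at h1 h2 h3 <;> simp only [one_smul, zero_smul] at h1 h2 h3 <;> omega
  · intro h
    by_cases hm : i < m
    · refine ⟨m - (i + 1), j, 0, by omega, ?_⟩
      rw [Nat.div_self hj]
      simp only [one_smul]
      omega
    · refine ⟨m, n, p, by omega, ?_⟩
      rw [Nat.div_eq_of_lt (by omega)]
      simp

theorem TU_span_z {r a : ℕ} (har : a ≤ r) {i i' j k : ℕ} (hi : i' < i) (hk : 1 ≤ k)
    (hΓ : IsGSet r a (spanSet {(i, j, 0), (i', 0, k)})) :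
    TU r a (spanSet {(i, j, 0), (i', 0, k)}) =
      spanSet {(i + i' + 1, 0, 0), (i, j, 0), (i', 0, k - 1)} := by
  have hwt : (i : ZMod r) + 1 = -(a : ZMod r) * k := by
    refine weight_succ_eq_of_bijective (-(a : ZMod r))
      (fun m n p => (m, p, n) ∈ spanSet {(i, j, 0), (i', 0, k)}) (k := j) hi hk
      (fun m n p => by simp [mem_spanSet_pair]; tauto) ?_ ?_
    · intro m n p m' n' p' h h' he
      have := hΓ.bij.injOn h h' (by rw [wtN_mk har, wtN_mk har]; linear_combination he)
      simp at this
      tauto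
    · intro x
      obtain ⟨⟨m, n, p⟩, hmem, h⟩ := hΓ.bij.surjOn (Set.mem_univ x)
      exact ⟨m, p, n, hmem, by rw [← h, wtN_mk har]; ring⟩
  have hv : wtG r a (spanSet {(i, j, 0), (i', 0, k)}) (i + 1, 0, 0) = (0, 0, k) :=
    hΓ.wtG_eq (by simp [mem_spanSet_pair]) (by
      rw [wtN_mk har, wtN_mk har]; push_cast; linear_combination -hwt)
  have hiOf : iOf (spanSet {(i, j, 0), (i', 0, k)}) = i :=
    iOf_eq fun m => by simp [mem_spanSet_pair]; omega
  ext ⟨m, n, p⟩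
  rw [TU, hiOf, jig, hv, mem_spanSet_triple]
  simp only [Set.mem_ofPred_eq, Prod.exists, mem_spanSet_pair, cmax_z hk, toZ, Prod.mk_le_mk,
    Prod.mk_sub_mk, Prod.smul_mk, Prod.mk_add_mk, Prod.mk.injEq]
  constructor
  · rintro ⟨m', n', p', hmem, h1, h2, h3⟩
    rw [div_eq_ite_of_le hk (by omega)] at h1 h2 h3
    split_ifs at h1 h2 h3 <;> simp only [one_smul, zero_smul] at h1 h2 h3 <;> omega
  · intro h
    by_cases hm : i < m
    · refine ⟨m - (i + 1), 0, k, by omega, ?_⟩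
      rw [Nat.div_self hk]
      simp only [one_smul]
      omega
    · refine ⟨m, n, p, by omega, ?_⟩
      rw [Nat.div_eq_of_lt (by omega)]
      simp

theorem IsGSet.ncard_eq {r a : ℕ} {Γ : Set N3} (hΓ : IsGSet r a Γ) : Γ.ncard = r := by
  rw [← hΓ.bij.injOn.ncard_image, hΓ.bij.image_eq, Set.ncard_univ, Nat.card_zmod]

theorem ncard_spanSet_one_zero {i i' : ℕ} (hi : i' < i) :
    (spanSet {(i', 1, 0), (i, 0, 0)}).ncard = i + i' + 2 := by
  have h : spanSet {(i', 1, 0), (i, 0, 0)} =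
      (fun t : ℕ => if t ≤ i then ((t, 0, 0) : N3) else (t - (i + 1), 1, 0)) ''
        (Finset.range (i + i' + 2) : Set ℕ) := by
    ext ⟨m, n, p⟩
    simp only [mem_spanSet_pair, Prod.mk_le_mk, Set.mem_image, Finset.mem_coe, Finset.mem_range]
    constructor
    · intro h
      by_cases hn : n = 0
      · exact ⟨m, by omega, by rw [if_pos (by omega)]; simp; omega⟩
      · exact ⟨m + (i + 1), by omega, by rw [if_neg (by omega)]; simp; omega⟩
    · rintro ⟨t, ht, he⟩
      split_ifs at he <;> simp only [Prod.mk.injEq] at he <;> omega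
  rw [h, Set.InjOn.ncard_image, Set.ncard_coe_finset, Finset.card_range]
  intro s _ t _ hst
  dsimp only at hst
  split_ifs at hst <;> simp only [Prod.mk.injEq] at hst <;> omega

/-- Classification of upper transformations of `G`-sets with exactly one valley. -/
theorem stmt10 (r a : ℕ) (hra : Nat.Coprime r a) (ha2 : 2 ≤ a) (halt : a < r - a) :
    (∀ (Γ : Set N3) (i iy j k : ℕ), IsGSet r a Γ →
      Γ = spanSet {(iy, j, 0), (i, 0, k)} → iy < i →
      IsYValley Γ iy 0 → (∀ m n : ℕ, IsYValley Γ m n → (m, n) = (iy, 0)) →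
      (∀ m n : ℕ, ¬ IsZValley Γ m n) →
      ((i, 0, 0) ∈ Γ ∧ (i + 1, 0, 0) ∉ Γ) →
      ((0, j, 0) ∈ Γ ∧ (0, j + 1, 0) ∉ Γ) →
      ((0, 0, k) ∈ Γ ∧ (0, 0, k + 1) ∉ Γ) →
      TU r a Γ = spanSet {(i + iy + 1, 0, 0), (iy, j - 1, 0), (i, 0, k)} ∧
      (j = 1 ∧ k = 0 → TU r a Γ = {v : N3 | ∃ m : ℕ, m ≤ r - 1 ∧ v = (m, 0, 0)}) ∧
      (j = 1 ∧ 0 < k →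
        IsZValley (TU r a Γ) i 0 ∧
        (∀ m n : ℕ, IsZValley (TU r a Γ) m n → (m, n) = (i, 0)) ∧
        (∀ m n : ℕ, ¬ IsYValley (TU r a Γ) m n)) ∧
      (2 ≤ j ∧ 0 < k →
        IsYValley (TU r a Γ) iy 0 ∧ IsZValley (TU r a Γ) i 0 ∧
        (∀ m n : ℕ, IsYValley (TU r a Γ) m n → (m, n) = (iy, 0)) ∧
        (∀ m n : ℕ, IsZValley (TU r a Γ) m n → (m, n) = (i, 0)))) ∧
    (∀ (Γ : Set N3) (i iz j k : ℕ), IsGSet r a Γ →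
      Γ = spanSet {(i, j, 0), (iz, 0, k)} → iz < i →
      IsZValley Γ iz 0 → (∀ m n : ℕ, IsZValley Γ m n → (m, n) = (iz, 0)) →
      (∀ m n : ℕ, ¬ IsYValley Γ m n) →
      ((i, 0, 0) ∈ Γ ∧ (i + 1, 0, 0) ∉ Γ) →
      ((0, j, 0) ∈ Γ ∧ (0, j + 1, 0) ∉ Γ) →
      ((0, 0, k) ∈ Γ ∧ (0, 0, k + 1) ∉ Γ) →
      TU r a Γ = spanSet {(i + iz + 1, 0, 0), (i, j, 0), (iz, 0, k - 1)}) := by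
  have har : a ≤ r := by omega
  refine ⟨?_, ?_⟩
  · rintro Γ i i' j k hΓ rfl hi hv - - - - -
    have hj : 1 ≤ j := by
      have := hv.2.2.1
      simp only [mem_spanSet_pair, Prod.mk_le_mk] at this
      omega
    have hTU := TU_span_y har hi hj hΓ
    rw [hTU]
    refine ⟨rfl, ?_, ?_, ?_⟩
    · rintro ⟨rfl, rfl⟩
      have hr := hΓ.ncard_eq
      rw [ncard_spanSet_one_zero hi] at hr
      ext ⟨m, n, p⟩
      simp only [mem_spanSet_triple, Prod.mk_le_mk, Set.mem_ofPred_eq, Prod.mk.injEq]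
      constructor
      · intro h
        exact ⟨m, by omega⟩
      · rintro ⟨t, h⟩
        omega
    · rintro ⟨rfl, hk⟩
      simp only [IsYValley, IsZValley, mem_spanSet_triple, Prod.mk_le_mk, Prod.mk.injEq]
      refine ⟨?_, ?_, ?_⟩ <;> intros <;> omega
    · rintro ⟨hj2, hk⟩
      simp only [IsYValley, IsZValley, mem_spanSet_triple, Prod.mk_le_mk, Prod.mk.injEq]
      refine ⟨?_, ?_, ?_, ?_⟩ <;> intros <;> omega
  · rintro Γ i i' j k hΓ rfl hi hv - - - - -
    have hk : 1 ≤ k := by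
      have := hv.2.2.1
      simp only [mem_spanSet_pair, Prod.mk_le_mk] at this
      omega
    exact TU_span_z har hi hk hΓ

end GH
end
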